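/- Suppose m = m_n and p = p_n satisfy n p = o(1), and let p̄ = 1 − e^{−m q̂ / C(n,2)} where q̂ = 1 − (1−p)^n − n p (1−p)^{n−1} and C(n,2) = n(n−1)/2. Then for any δ > 0 there exist a coupling of the random intersection graph G(n,m,p) and the Erdős–Rényi random graph G(n,p̄) (in which every pair of the n vertices is an edge independently with probability p̄), a sequence ε_n → 0, and a constant C, such that with high probability |mod(G(n,m,p)) − mod(G(n,p̄))| ≤ ε_n · mod(G(n,p̄)) + C (np)^{1−δ}. -/

import Mathlib

open MeasureTheory Filter Topology
open scoped Classical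

namespace RIG

variable {V : Type*}

/-- The number of edges of a graph. -/
noncomputable def edgeCount [Fintype V] (G : SimpleGraph V) : ℕ := G.edgeSet.ncard

/-- The number of edges of `G` with both endpoints in `S`. -/
noncomputable def edgesIn [Fintype V] (G : SimpleGraph V) (S : Finset V) : ℕ :=
  {e ∈ G.edgeSet | ∀ v ∈ e, v ∈ S}.ncard

/-- The number of edges of `G` with exactly one endpoint in `S`. -/
noncomputable def crossEdges [Fintype V] (G : SimpleGraph V) (S : Finset V) : ℕ :=
  {e ∈ G.edgeSet | (∃ v ∈ e, v ∈ S) ∧ ∃ v ∈ e, v ∉ S}.ncard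

/-- The sum of the degrees (in `G`) of the vertices of `S`. -/
noncomputable def vol [Fintype V] (G : SimpleGraph V) (S : Finset V) : ℕ :=
  ∑ v ∈ S, G.degree v

/-- The modularity score of a partition of the vertex set. -/
noncomputable def modScore [Fintype V] [DecidableEq V] (G : SimpleGraph V)
    (P : Finpartition (Finset.univ : Finset V)) : ℝ :=
  ∑ S ∈ P.parts,
    ((edgesIn G S : ℝ) / (edgeCount G : ℝ) -
      ((vol G S : ℝ) / (vol G Finset.univ : ℝ)) ^ 2)

/-- The modularity of a graph: the maximum of the modularity scores over all
partitions of the vertex set. -/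
noncomputable def modularity [Fintype V] [DecidableEq V] (G : SimpleGraph V) : ℝ :=
  ⨆ P : Finpartition (Finset.univ : Finset V), modScore G P

/-- The Bernoulli measure on `Bool` with success probability `p`. -/
noncomputable def bernoulliB (p : ℝ) : Measure Bool :=
  ENNReal.ofReal p • Measure.dirac true + ENNReal.ofReal (1 - p) • Measure.dirac false

/-- The law of the attribute assignment of the binomial random intersection graph
`G(n,m,p)`: each vertex chooses each attribute independently with probability `p`. -/
noncomputable def rigMeasure (n m : ℕ) (p : ℝ) : Measure (Fin n → Fin m → Bool) :=
  Measure.pi fun _ => Measure.pi fun _ => bernoulliB p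

/-- The intersection graph determined by an attribute assignment: two distinct vertices
are adjacent iff they share an attribute. -/
def rigGraph {n m : ℕ} (ω : Fin n → Fin m → Bool) : SimpleGraph (Fin n) :=
  SimpleGraph.fromRel fun u v => ∃ i, ω u i = true ∧ ω v i = true

/-- `q̂ = 1 - (1-p)^n - n p (1-p)^{n-1}`. -/
noncomputable def qhat (n : ℕ) (p : ℝ) : ℝ :=
  1 - (1 - p) ^ n - (n : ℝ) * p * (1 - p) ^ (n - 1)

/-- `p̄ = 1 - exp(- m q̂ / C(n,2))`. -/
noncomputable def pbar (n m : ℕ) (p : ℝ) : ℝ :=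
  1 - Real.exp (-((m : ℝ) * qhat n p) / ((n : ℝ) * ((n : ℝ) - 1) / 2))

/-- The law of the edge-indicators of the Erdős–Rényi random graph `G(n,q)`:
each (unordered) pair is an edge independently with probability `q`. -/
noncomputable def erMeasure (n : ℕ) (q : ℝ) : Measure (Sym2 (Fin n) → Bool) :=
  Measure.pi fun _ => bernoulliB q

/-- The graph determined by edge indicators `χ : Sym2 (Fin n) → Bool`. -/
def erGraph {n : ℕ} (χ : Sym2 (Fin n) → Bool) : SimpleGraph (Fin n) :=
  SimpleGraph.fromRel fun u v => χ s(u, v) = true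


set_option linter.unusedSectionVars false
set_option linter.unusedVariables false

section Robust

variable [Fintype V] [DecidableEq V]

/-- The edge set as a finset (classical instances). -/
noncomputable def EF (G : SimpleGraph V) : Finset (Sym2 V) :=
  Finset.univ.filter (fun e => e ∈ G.edgeSet)

/-- The symmetric difference of two edge sets. -/
noncomputable def DF (G H : SimpleGraph V) : Finset (Sym2 V) :=
  Finset.univ.filter (fun e => ¬ (e ∈ G.edgeSet ↔ e ∈ H.edgeSet))

lemma edgeCount_eq (G : SimpleGraph V) : edgeCount G = (EF G).card := by
  unfold edgeCount EF
  rw [← Set.ncard_coe_finset]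
  congr 1
  ext e
  simp

lemma edgesIn_eq (G : SimpleGraph V) (S : Finset V) :
    edgesIn G S = ((EF G).filter (fun e => ∀ v ∈ e, v ∈ S)).card := by
  unfold edgesIn EF
  rw [← Set.ncard_coe_finset]
  congr 1
  ext e
  simp

lemma degree_eq (G : SimpleGraph V) [Fintype (G.neighborSet v)] :
    G.degree v = ((EF G).filter (fun e => v ∈ e)).card := by
  rw [← SimpleGraph.card_incidenceFinset_eq_degree]
  congr 1
  ext e
  simp [EF, SimpleGraph.incidenceSet]

lemma card_diff_le (G H : SimpleGraph V) (Q : Sym2 V → Prop) [DecidablePred Q] :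
    |(((EF G).filter Q).card : ℝ) - (((EF H).filter Q).card : ℝ)| ≤
      (((DF G H).filter Q).card : ℝ) := by
  have h1 : ((EF G).filter Q).card ≤ ((EF H).filter Q).card + ((DF G H).filter Q).card := by
    refine le_trans (Finset.card_le_card ?_) (Finset.card_union_le _ _)
    intro e
    simp only [EF, DF, Finset.mem_filter, Finset.mem_union, Finset.mem_univ, true_and]
    tauto
  have h2 : ((EF H).filter Q).card ≤ ((EF G).filter Q).card + ((DF G H).filter Q).card := by
    refine le_trans (Finset.card_le_card ?_) (Finset.card_union_le _ _)
    intro e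
    simp only [EF, DF, Finset.mem_filter, Finset.mem_union, Finset.mem_univ, true_and]
    tauto
  have h1' : (((EF G).filter Q).card : ℝ) ≤ ((EF H).filter Q).card + ((DF G H).filter Q).card := by
    exact_mod_cast h1
  have h2' : (((EF H).filter Q).card : ℝ) ≤ ((EF G).filter Q).card + ((DF G H).filter Q).card := by
    exact_mod_cast h2
  rw [abs_le]
  constructor <;> linarith

lemma card_diff_le' (G H : SimpleGraph V) :
    |((EF G).card : ℝ) - ((EF H).card : ℝ)| ≤ ((DF G H).card : ℝ) := by
  simpa using card_diff_le G H (fun _ => True)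

lemma sum_parts_le (P : Finpartition (Finset.univ : Finset V)) (F : Finset (Sym2 V)) :
    ∑ S ∈ P.parts, (F.filter (fun e => ∀ v ∈ e, v ∈ S)).card ≤ F.card := by
  rw [← Finset.card_biUnion]
  · apply Finset.card_le_card
    intro e
    simp only [Finset.mem_biUnion, Finset.mem_filter]
    rintro ⟨S, _, h, _⟩
    exact h
  · intro S hS T hT hST
    have := P.disjoint hS hT hST
    rw [Function.onFun, Finset.disjoint_left]
    intro e he he'
    simp only [Finset.mem_filter] at he he'
    induction e using Sym2.ind with
    | _ a b =>
      exact (Finset.disjoint_left.mp this) (he.2 a (by simp)) (he'.2 a (by simp))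

lemma sum_vert_le (F : Finset (Sym2 V)) :
    ∑ v : V, (F.filter (fun e => v ∈ e)).card ≤ 2 * F.card := by
  have : ∑ v : V, (F.filter (fun e => v ∈ e)).card
      = ∑ e ∈ F, (Finset.univ.filter (fun v => v ∈ e)).card := by
    simp only [Finset.card_filter]
    exact Finset.sum_comm
  rw [this, mul_comm, ← smul_eq_mul]
  apply Finset.sum_le_card_nsmul
  intro e _
  induction e using Sym2.ind with
  | _ a b =>
    refine le_trans (Finset.card_le_card (t := {a, b}) ?_) Finset.card_le_two
    intro x
    simp

lemma sum_parts_sum (P : Finpartition (Finset.univ : Finset V)) (f : V → ℝ) :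
    ∑ S ∈ P.parts, ∑ v ∈ S, f v = ∑ v, f v := by
  have := Finset.sum_biUnion (f := f) (s := P.parts) (t := id) P.disjoint
  have h2 := P.sup_parts
  rw [Finset.sup_eq_biUnion] at h2
  rw [h2] at this
  exact this.symm

lemma div_diff_le {I I' e e' D : ℝ} (hI : 0 ≤ I) (hIe : I ≤ e) (he' : 0 < e') 
    (h : |I - I'| ≤ D₁) (hd : |e - e'| ≤ D) :
    |I / e - I' / e'| ≤ D₁ / e' + I / e * (D / e') := by
  rcases eq_or_lt_of_le (hI.trans hIe) with h0 | h0
  · subst h0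
    have : I = 0 := le_antisymm hIe hI
    subst this
    simp only [div_zero, zero_sub, abs_neg, abs_div, abs_of_pos he', zero_mul, add_zero] at *
    gcongr
  · have e1 : I / e - I' / e' = (I - I') / e' + I / e * ((e' - e) / e') := by
      field_simp; ring
    rw [e1]
    refine (abs_add_le _ _).trans ?_
    rw [abs_mul, abs_div, abs_div, abs_div, abs_of_pos he', abs_of_pos h0, abs_of_nonneg hI,
      abs_sub_comm e' e]
    gcongr

lemma vol_univ (G : SimpleGraph V) : (vol G Finset.univ : ℝ) = 2 * (EF G).card := by
  have h := SimpleGraph.sum_degrees_eq_twice_card_edges G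
  have h2 : G.edgeFinset.card = (EF G).card := by
    congr 1
    ext e
    simp [EF]
  rw [h2] at h
  unfold vol
  exact_mod_cast h

lemma vol_diff (G H : SimpleGraph V) (S : Finset V) :
    |(vol G S : ℝ) - vol H S| ≤ ∑ v ∈ S, (((DF G H).filter (fun e => v ∈ e)).card : ℝ) := by
  unfold vol
  push_cast
  rw [← Finset.sum_sub_distrib]
  refine (Finset.abs_sum_le_sum_abs _ _).trans (Finset.sum_le_sum fun v _ => ?_)
  rw [degree_eq, degree_eq]
  exact card_diff_le G H _

lemma sum_vol (G : SimpleGraph V) (P : Finpartition (Finset.univ : Finset V)) :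
    ∑ S ∈ P.parts, (vol G S : ℝ) = vol G Finset.univ := by
  unfold vol
  push_cast
  exact sum_parts_sum P _

lemma score_diff (G H : SimpleGraph V) (P : Finpartition (Finset.univ : Finset V))
    (hH : 0 < (EF H).card) :
    |modScore G P - modScore H P| ≤ 6 * ((DF G H).card : ℝ) / ((EF H).card : ℝ) := by
  set D : ℝ := ((DF G H).card : ℝ) with hD
  set e : ℝ := ((EF G).card : ℝ) with he
  set e' : ℝ := ((EF H).card : ℝ) with he'
  have hD0 : 0 ≤ D := by positivity
  have he0 : 0 ≤ e := by positivity
  have he'0 : 0 < e' := by rw [he']; exact_mod_cast hH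
  have hde : |e - e'| ≤ D := card_diff_le' G H
  -- the edge part
  have hA : |(∑ S ∈ P.parts, (edgesIn G S : ℝ)) / e - (∑ S ∈ P.parts, (edgesIn H S : ℝ)) / e'|
      ≤ 2 * D / e' := by
    have hI : ∑ S ∈ P.parts, (edgesIn G S : ℝ) ≤ e := by
      simp only [edgesIn_eq]
      rw [he]
      exact_mod_cast sum_parts_le P (EF G)
    have hII : |(∑ S ∈ P.parts, (edgesIn G S : ℝ)) - ∑ S ∈ P.parts, (edgesIn H S : ℝ)| ≤ D := by
      rw [← Finset.sum_sub_distrib]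
      refine (Finset.abs_sum_le_sum_abs _ _).trans ?_
      have h3 : ∑ S ∈ P.parts, (((DF G H).filter (fun e => ∀ v ∈ e, v ∈ S)).card : ℝ) ≤ D := by
        rw [hD]
        exact_mod_cast sum_parts_le P (DF G H)
      refine le_trans (Finset.sum_le_sum fun S _ => ?_) h3
      rw [edgesIn_eq, edgesIn_eq]
      exact card_diff_le G H _
    have h0 : 0 ≤ ∑ S ∈ P.parts, (edgesIn G S : ℝ) := by positivity
    have := div_diff_le h0 hI he'0 hII hde
    have h1 : (∑ S ∈ P.parts, (edgesIn G S : ℝ)) / e ≤ 1 := div_le_one_of_le₀ hI he0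
    have h2 : (∑ S ∈ P.parts, (edgesIn G S : ℝ)) / e * (D / e') ≤ 1 * (D / e') := by
      gcongr
    calc _ ≤ _ := this
      _ ≤ D / e' + 1 * (D / e') := by gcongr
      _ = _ := by ring
  -- the degree part
  have hVS : ∀ (K : SimpleGraph V) (S : Finset V), (vol K S : ℝ) ≤ vol K Finset.univ := by
    intro K S
    unfold vol
    exact_mod_cast Finset.sum_le_sum_of_subset (Finset.subset_univ S)
  have hB : |∑ S ∈ P.parts, ((vol G S : ℝ) / (vol G Finset.univ : ℝ)) ^ 2 -
      ∑ S ∈ P.parts, ((vol H S : ℝ) / (vol H Finset.univ : ℝ)) ^ 2| ≤ 4 * D / e' := by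
    rw [← Finset.sum_sub_distrib]
    refine (Finset.abs_sum_le_sum_abs _ _).trans ?_
    have hterm : ∀ S ∈ P.parts, |((vol G S : ℝ) / (vol G Finset.univ : ℝ)) ^ 2 -
        ((vol H S : ℝ) / (vol H Finset.univ : ℝ)) ^ 2| ≤
        2 * ((∑ v ∈ S, (((DF G H).filter (fun e => v ∈ e)).card : ℝ)) / (2 * e') +
          (vol G S : ℝ) / (vol G Finset.univ : ℝ) * ((2 * D) / (2 * e'))) := by
      intro S _
      have h2e' : 0 < (vol H Finset.univ : ℝ) := by rw [vol_univ]; positivity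
      have hd2 : |(vol G Finset.univ : ℝ) - vol H Finset.univ| ≤ 2 * D := by
        rw [vol_univ, vol_univ, ← mul_sub, abs_mul, abs_two]
        gcongr
      have := div_diff_le (by positivity) (hVS G S) h2e' (vol_diff G H S) hd2
      have ha : (vol G S : ℝ) / (vol G Finset.univ : ℝ) ≤ 1 :=
        div_le_one_of_le₀ (hVS G S) (by positivity)
      have hb : (vol H S : ℝ) / (vol H Finset.univ : ℝ) ≤ 1 :=
        div_le_one_of_le₀ (hVS H S) (by positivity)
      have ha0 : 0 ≤ (vol G S : ℝ) / (vol G Finset.univ : ℝ) := by positivity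
      have hb0 : 0 ≤ (vol H S : ℝ) / (vol H Finset.univ : ℝ) := by positivity
      rw [sq_sub_sq, abs_mul, abs_of_nonneg (add_nonneg ha0 hb0)]
      rw [vol_univ H] at this
      rw [vol_univ H] at hb hb0 ⊢
      apply mul_le_mul _ this (abs_nonneg _) (by norm_num)
      linarith
    refine (Finset.sum_le_sum hterm).trans ?_
    rw [← Finset.mul_sum, Finset.sum_add_distrib, ← Finset.sum_div, ← Finset.sum_mul,
      ← Finset.sum_div, sum_vol, sum_parts_sum]
    have h1 : (∑ v : V, (((DF G H).filter (fun e => v ∈ e)).card : ℝ)) ≤ 2 * D := by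
      rw [hD]
      exact_mod_cast sum_vert_le (DF G H)
    have h2 : (vol G Finset.univ : ℝ) / (vol G Finset.univ : ℝ) ≤ 1 := div_self_le_one _
    calc _ ≤ 2 * ((2 * D) / (2 * e') + 1 * ((2 * D) / (2 * e'))) := by gcongr
      _ = _ := by field_simp; ring
  unfold modScore
  rw [Finset.sum_sub_distrib, Finset.sum_sub_distrib, ← Finset.sum_div, ← Finset.sum_div,
    edgeCount_eq, edgeCount_eq]
  have h6 : 6 * D / e' = 2 * D / e' + 4 * D / e' := by ring
  rw [h6]
  rw [abs_le] at hA hB ⊢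
  constructor <;> linarith [hA.1, hA.2, hB.1, hB.2]

lemma finite_finpartition : Finite (Finpartition (Finset.univ : Finset V)) :=
  Finite.of_injective (fun P => P.parts) (fun P Q h => by
    ext1; exact h)

lemma iSup_diff_le {ι : Type*} [Finite ι] [Nonempty ι] (f g : ι → ℝ) (c : ℝ)
    (h : ∀ i, |f i - g i| ≤ c) : |(⨆ i, f i) - ⨆ i, g i| ≤ c := by
  have hf : BddAbove (Set.range f) := (Set.finite_range f).bddAbove
  have hg : BddAbove (Set.range g) := (Set.finite_range g).bddAbove
  have h1 : (⨆ i, f i) ≤ (⨆ i, g i) + c := ciSup_le fun i => by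
    have := le_ciSup hg i
    have := (abs_le.mp (h i)).2
    linarith
  have h2 : (⨆ i, g i) ≤ (⨆ i, f i) + c := ciSup_le fun i => by
    have := le_ciSup hf i
    have := (abs_le.mp (h i)).1
    linarith
  rw [abs_le]
  constructor <;> linarith

lemma mod_diff (G H : SimpleGraph V) (hH : 0 < (EF H).card) :
    |modularity G - modularity H| ≤ 6 * ((DF G H).card : ℝ) / ((EF H).card : ℝ) := by
  have := finite_finpartition (V := V)
  exact iSup_diff_le _ _ _ fun P => score_diff G H P hH

lemma eq_of_DF (G H : SimpleGraph V) (h : DF G H = ∅) : G = H := by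
  rw [← SimpleGraph.edgeSet_inj]
  ext e
  by_contra hc
  have : e ∈ DF G H := by simp [DF, hc]
  rw [h] at this
  simp at this

end Robust

section Qhat

lemma qhat_succ (n : ℕ) (p : ℝ) :
    qhat (n + 1) p = qhat n p + n * p ^ 2 * (1 - p) ^ (n - 1) := by
  unfold qhat
  cases n with
  | zero => simp
  | succ k => simp only [Nat.add_sub_cancel]; push_cast; ring

lemma qhat_le (n : ℕ) (p : ℝ) (h0 : 0 ≤ p) (h1 : p ≤ 1) :
    qhat n p ≤ (n : ℝ) * ((n : ℝ) - 1) / 2 * p ^ 2 := by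
  induction n with
  | zero => simp [qhat]
  | succ k ih =>
    rw [qhat_succ]
    have h2 : (1 - p) ^ (k - 1) ≤ 1 := pow_le_one₀ (by linarith) (by linarith)
    have : (k : ℝ) * p ^ 2 * (1 - p) ^ (k - 1) ≤ k * p ^ 2 * 1 := by gcongr
    push_cast
    linarith

lemma qhat_nonneg (n : ℕ) (p : ℝ) (h0 : 0 ≤ p) (h1 : p ≤ 1) : 0 ≤ qhat n p := by
  induction n with
  | zero => simp [qhat]
  | succ k ih =>
    rw [qhat_succ]
    have : 0 ≤ (1 - p) := by linarith
    positivity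

lemma qhat_ge (n : ℕ) (p : ℝ) (h0 : 0 ≤ p) (h1 : p ≤ 1) :
    (n : ℝ) * ((n : ℝ) - 1) / 2 * p ^ 2 * (1 - p) ^ n ≤ qhat n p := by
  have h2 : 0 ≤ 1 - p := by linarith
  induction n with
  | zero => simp [qhat]
  | succ k ih =>
    rw [qhat_succ]
    have a1 : (1 - p) ^ (k + 1) ≤ (1 - p) ^ k := pow_le_pow_of_le_one h2 (by linarith) (by omega)
    have a2 : (1 - p) ^ (k + 1) ≤ (1 - p) ^ (k - 1) :=
      pow_le_pow_of_le_one h2 (by linarith) (by omega)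
    have a3 : (k : ℝ) * p ^ 2 * (1 - p) ^ (k + 1) ≤ k * p ^ 2 * (1 - p) ^ (k - 1) := by gcongr
    have a4 : (k : ℝ) * ((k : ℝ) - 1) / 2 * p ^ 2 * (1 - p) ^ (k + 1) ≤
        (k : ℝ) * ((k : ℝ) - 1) / 2 * p ^ 2 * (1 - p) ^ k := by
      have : 0 ≤ (k : ℝ) * ((k : ℝ) - 1) := by
        cases k with
        | zero => simp
        | succ j => push_cast; simp; positivity
      gcongr
    push_cast
    have : ((k : ℝ) + 1) * ((k : ℝ) + 1 - 1) / 2 * p ^ 2 * (1 - p) ^ (k + 1)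
      = (k : ℝ) * ((k : ℝ) - 1) / 2 * p ^ 2 * (1 - p) ^ (k + 1) +
        (k : ℝ) * p ^ 2 * (1 - p) ^ (k + 1) := by ring
    rw [this]
    linarith

lemma one_sub_pow_ge (x : ℝ) (h0 : 0 ≤ x) (h1 : x ≤ 1) (n : ℕ) : 1 - n * x ≤ (1 - x) ^ n := by
  have := one_add_mul_le_pow (a := -x) (by linarith) n
  have h : 1 + -x = 1 - x := by ring
  rw [h] at this
  linarith

/-- per-attribute edge probability `s`. -/
noncomputable def sOf (n : ℕ) (p : ℝ) : ℝ :=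
  1 - Real.exp (-(qhat n p / ((n : ℝ) * ((n : ℝ) - 1) / 2)))

lemma Nn_nonneg (n : ℕ) : 0 ≤ (n : ℝ) * ((n : ℝ) - 1) / 2 := by
  cases n with
  | zero => simp
  | succ j => push_cast; simp; positivity

lemma pbar_eq (n m : ℕ) (p : ℝ) : pbar n m p = 1 - (1 - sOf n p) ^ m := by
  unfold pbar sOf
  rw [sub_sub_cancel, ← Real.exp_nat_mul]
  congr 2
  ring

lemma y_le (n : ℕ) (p : ℝ) (h0 : 0 ≤ p) (h1 : p ≤ 1) :
    qhat n p / ((n : ℝ) * ((n : ℝ) - 1) / 2) ≤ p ^ 2 := by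
  apply div_le_of_le_mul₀ (Nn_nonneg n) (by positivity)
  have := qhat_le n p h0 h1
  linarith

lemma sOf_nonneg (n : ℕ) (p : ℝ) (h0 : 0 ≤ p) (h1 : p ≤ 1) : 0 ≤ sOf n p := by
  unfold sOf
  have := div_nonneg (qhat_nonneg n p h0 h1) (Nn_nonneg n)
  have := Real.exp_le_one_iff.mpr (neg_nonpos.mpr this)
  linarith

lemma sOf_le (n : ℕ) (p : ℝ) (h0 : 0 ≤ p) (h1 : p ≤ 1) : sOf n p ≤ p ^ 2 := by
  unfold sOf
  have := y_le n p h0 h1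
  have := Real.add_one_le_exp (-(qhat n p / ((n : ℝ) * ((n : ℝ) - 1) / 2)))
  linarith

lemma sOf_ge (n : ℕ) (hn : 2 ≤ n) (p : ℝ) (h0 : 0 ≤ p) (h1 : p ≤ 1) (ht : n * p ≤ 1) :
    p ^ 2 * (1 - 2 * (n * p)) ≤ sOf n p := by
  have hn' : (2 : ℝ) ≤ n := by exact_mod_cast hn
  have hy := y_le n p h0 h1
  have hN : 0 < (n : ℝ) * ((n : ℝ) - 1) / 2 := by
    have : 0 < (n : ℝ) - 1 := by linarith
    positivity
  have hy0 := div_nonneg (qhat_nonneg n p h0 h1) (Nn_nonneg n)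
  have hyl : p ^ 2 * (1 - n * p) ≤ qhat n p / ((n : ℝ) * ((n : ℝ) - 1) / 2) := by
    rw [le_div_iff₀ hN]
    refine le_trans ?_ (qhat_ge n p h0 h1)
    have := one_sub_pow_ge p h0 h1 n
    calc _ = (n : ℝ) * ((n : ℝ) - 1) / 2 * p ^ 2 * (1 - n * p) := by ring
      _ ≤ _ := by gcongr
  unfold sOf
  set y := qhat n p / ((n : ℝ) * ((n : ℝ) - 1) / 2) with hydef
  have hp2 : p ^ 2 ≤ n * p := by nlinarith
  have hexp : Real.exp (-y) ≤ 1 - y + y ^ 2 := by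
    have hy1 : y ≤ 1 := by linarith
    have := Real.abs_exp_sub_one_sub_id_le (x := -y) (by rw [abs_neg, abs_of_nonneg hy0]; exact hy1)
    have := (abs_le.mp this).2
    nlinarith
  have e1 : y * (1 - n * p) ≤ y - y ^ 2 := by nlinarith
  have e2 : p ^ 2 * (1 - n * p) * (1 - n * p) ≤ y * (1 - n * p) := by
    apply mul_le_mul_of_nonneg_right hyl; linarith
  nlinarith [mul_nonneg (sq_nonneg p) (sq_nonneg ((n : ℝ) * p))]

lemma pbar_nonneg (n m : ℕ) (p : ℝ) (h0 : 0 ≤ p) (h1 : p ≤ 1) : 0 ≤ pbar n m p := by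
  rw [pbar_eq]
  have h2 := sOf_nonneg n p h0 h1
  have h3 := sOf_le n p h0 h1
  have : (1 - sOf n p) ^ m ≤ 1 := pow_le_one₀ (by nlinarith) (by linarith)
  linarith

lemma pbar_le_one (n m : ℕ) (p : ℝ) : pbar n m p ≤ 1 := by
  unfold pbar
  linarith [Real.exp_pos (-((m : ℝ) * qhat n p) / ((n : ℝ) * ((n : ℝ) - 1) / 2))]

lemma pbar_ge (n m : ℕ) (p : ℝ) (h0 : 0 ≤ p) (h1 : p ≤ 1) :
    m * sOf n p * (1 - sOf n p) ^ (m - 1) ≤ pbar n m p := by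
  rw [pbar_eq]
  have h2 := sOf_nonneg n p h0 h1
  have h3 : sOf n p ≤ 1 := by have := sOf_le n p h0 h1; nlinarith
  generalize sOf n p = s at *
  induction m with
  | zero => simp
  | succ k ih =>
    cases k with
    | zero => simp
    | succ j =>
      simp only [Nat.add_sub_cancel] at *
      have : (1 - s) ^ (j + 1) ≤ (1 - s) ^ j := pow_le_pow_of_le_one (by linarith) (by linarith) (by omega)
      push_cast at *
      have h4 : ((j : ℝ) + 1) * s * (1 - s) ^ (j + 1) ≤ ((j : ℝ) + 1) * s * (1 - s) ^ j := by gcongr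
      have h5 : (1 - s) ^ (j + 1 + 1) = (1 - s) ^ (j + 1) - s * (1 - s) ^ (j + 1) := by ring
      rw [h5]
      linarith

end Qhat

section Coupling

lemma bern_prob (p : ℝ) (h0 : 0 ≤ p) (h1 : p ≤ 1) : IsProbabilityMeasure (bernoulliB p) := by
  constructor
  simp [bernoulliB, ← ENNReal.ofReal_add h0 (sub_nonneg.mpr h1)]

lemma bern_true (p : ℝ) : bernoulliB p {true} = ENNReal.ofReal p := by
  simp [bernoulliB]

lemma bern_false (p : ℝ) : bernoulliB p {false} = ENNReal.ofReal (1 - p) := by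
  simp [bernoulliB]

lemma sum_dirac_le {ι X : Type*} [Fintype ι] [MeasurableSpace X] [MeasurableSingletonClass X]
    (μ : Measure X) (g : ι → X) (hg : Function.Injective g) (γ : ENNReal)
    (h : ∀ i, γ ≤ μ {g i}) : (∑ i, γ • Measure.dirac (g i)) ≤ μ := by
  rw [Measure.le_iff]
  intro s hs
  rw [Measure.finsetSum_apply]
  have h1 : ∀ i, (γ • Measure.dirac (g i)) s ≤ if g i ∈ s then μ {g i} else 0 := by
    intro i
    by_cases hi : g i ∈ s
    · simp [hi, h i]
    · simp [hi, Measure.dirac_apply' _ hs]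
  refine (Finset.sum_le_sum fun i _ => h1 i).trans ?_
  rw [← Finset.sum_filter]
  rw [← measure_biUnion_finset]
  · apply measure_mono
    intro x
    simp only [Finset.mem_filter, Finset.mem_univ, true_and, Set.mem_iUnion, exists_prop,
      Set.mem_singleton_iff]
    rintro ⟨i, hi, rfl⟩
    exact hi
  · intro i _ j _ hij
    simp only [Function.onFun, Set.disjoint_singleton]
    exact fun hc => hij (hg hc)
  · intro i _
    exact measurableSet_singleton _

lemma map_sum_dirac {ι X Y : Type*} [Fintype ι] [MeasurableSpace X] [MeasurableSpace Y]
    (g : ι → X) (γ : ENNReal) (f : X → Y) (hf : Measurable f) :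
    (∑ i, γ • Measure.dirac (g i)).map f = ∑ i, γ • Measure.dirac (f (g i)) := by
  ext s hs
  rw [Measure.map_apply hf hs, Measure.finsetSum_apply, Measure.finsetSum_apply]
  refine Finset.sum_congr rfl fun i _ => ?_
  simp [Measure.dirac_apply' _ hs, Measure.dirac_apply' _ (hf hs), Set.indicator]

lemma coupling_exists {ι X Y : Type*} [Fintype ι] [MeasurableSpace X] [MeasurableSingletonClass X]
    [MeasurableSpace Y] [MeasurableSingletonClass Y]
    (μ : Measure X) (ν : Measure Y) [IsProbabilityMeasure μ] [IsProbabilityMeasure ν]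
    (g : ι → X) (hg : Function.Injective g) (h : ι → Y) (hh : Function.Injective h)
    (γ : ENNReal) (hγ : γ ≠ ⊤) (h1 : ∀ i, γ ≤ μ {g i}) (h2 : ∀ i, γ ≤ ν {h i}) :
    ∃ κ : Measure (X × Y), κ.map Prod.fst = μ ∧ κ.map Prod.snd = ν ∧
      ∀ i, γ ≤ κ {(g i, h i)} := by
  set θ₁ : Measure X := ∑ i, γ • Measure.dirac (g i) with hθ₁
  set θ₂ : Measure Y := ∑ i, γ • Measure.dirac (h i) with hθ₂
  have l1 : θ₁ ≤ μ := sum_dirac_le μ g hg γ h1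
  have l2 : θ₂ ≤ ν := sum_dirac_le ν h hh γ h2
  have : IsFiniteMeasure θ₁ := isFiniteMeasure_of_le μ l1
  have : IsFiniteMeasure θ₂ := isFiniteMeasure_of_le ν l2
  have e1 : μ - θ₁ + θ₁ = μ := Measure.sub_add_cancel_of_le l1
  have e2 : ν - θ₂ + θ₂ = ν := Measure.sub_add_cancel_of_le l2
  have m12 : θ₁ Set.univ = θ₂ Set.univ := by
    simp [hθ₁, hθ₂]
  have r1 : (μ - θ₁) Set.univ = 1 - θ₁ Set.univ := by
    rw [Measure.sub_apply MeasurableSet.univ l1, measure_univ]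
  have r2 : (ν - θ₂) Set.univ = 1 - θ₁ Set.univ := by
    rw [Measure.sub_apply MeasurableSet.univ l2, measure_univ, m12]
  set r : ENNReal := 1 - θ₁ Set.univ with hr
  have hrt : r ≠ ⊤ := ne_top_of_le_ne_top ENNReal.one_ne_top tsub_le_self
  have key : ∀ {Z : Type _} [MeasurableSpace Z] (ρ : Measure Z), ρ Set.univ = r →
      r⁻¹ • r • ρ = ρ := by
    intro Z _ ρ hρ
    by_cases hr0 : r = 0
    · rw [hr0, Measure.measure_univ_eq_zero] at hρ
      simp [hρ]
    · rw [smul_smul, ENNReal.inv_mul_cancel hr0 hrt, one_smul]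
  refine ⟨(∑ i, γ • Measure.dirac (g i, h i)) + r⁻¹ • ((μ - θ₁).prod (ν - θ₂)), ?_, ?_, ?_⟩
  · rw [Measure.map_add _ _ measurable_fst, map_sum_dirac _ _ _ measurable_fst, Measure.map_smul,
      Measure.map_fst_prod, r2, key _ r1, add_comm]
    exact e1
  · rw [Measure.map_add _ _ measurable_snd, map_sum_dirac _ _ _ measurable_snd, Measure.map_smul,
      Measure.map_snd_prod, r1]
    have key2 : r⁻¹ • r • (ν - θ₂) = ν - θ₂ := by
      by_cases hr0 : r = 0
      · rw [hr0, Measure.measure_univ_eq_zero] at r2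
        simp [r2]
      · rw [smul_smul, ENNReal.inv_mul_cancel hr0 hrt, one_smul]
    rw [key2, add_comm]
    exact e2
  · intro i
    rw [Measure.add_apply, Measure.finsetSum_apply]
    refine le_trans ?_ le_self_add
    refine le_trans ?_ (Finset.single_le_sum (fun _ _ => bot_le) (Finset.mem_univ i))
    simp

end Coupling

section Single

/-- the attribute column equal to the indicator of the edge. -/
noncomputable def xE {n : ℕ} (e : Sym2 (Fin n)) : Fin n → Bool := fun v => decide (v ∈ e)

/-- the edge vector with only one edge present. -/
noncomputable def cE {n : ℕ} (e : Sym2 (Fin n)) : Sym2 (Fin n) → Bool := fun f => decide (f = e)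

lemma xE_inj {n : ℕ} : Function.Injective (xE (n := n)) := by
  intro e f h
  ext v
  have := congrFun h v
  simpa [xE] using this

lemma cE_inj {n : ℕ} : Function.Injective (cE (n := n)) := by
  intro e f h
  have := congrFun h e
  simpa [cE] using this

lemma card_mem {n : ℕ} (e : Sym2 (Fin n)) (he : ¬ e.IsDiag) :
    (Finset.univ.filter (fun v => v ∈ e)).card = 2 := by
  induction e using Sym2.ind with
  | _ a b =>
    have hab : a ≠ b := by simpa using he
    rw [← Finset.card_pair hab]
    congr 1
    ext x
    simp

lemma card_sym2_le (n : ℕ) : Fintype.card (Sym2 (Fin n)) ≤ n ^ 2 := by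
  have := Fintype.card_le_of_surjective (fun x : Fin n × Fin n => s(x.1, x.2))
    (fun e => by
      induction e using Sym2.ind with
      | _ a b => exact ⟨(a, b), rfl⟩)
  simpa [sq] using this

lemma xE_mass {n : ℕ} (p : ℝ) (h0 : 0 ≤ p) (h1 : p ≤ 1) (e : Sym2 (Fin n)) (he : ¬ e.IsDiag) :
    ENNReal.ofReal (p ^ 2 * (1 - p) ^ n) ≤
      (Measure.pi fun _ : Fin n => bernoulliB p) {xE e} := by
  have := bern_prob p h0 h1
  rw [Measure.pi_singleton]
  have : ∀ v, bernoulliB p {xE e v} = if v ∈ e then ENNReal.ofReal p else ENNReal.ofReal (1 - p) := by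
    intro v
    by_cases hv : v ∈ e
    · simp [xE, hv, bern_true]
    · simp [xE, hv, bern_false]
  simp only [this]
  rw [Finset.prod_ite, Finset.prod_const, Finset.prod_const, card_mem e he,
    ENNReal.ofReal_mul (by positivity), ENNReal.ofReal_pow h0, ENNReal.ofReal_pow (by linarith)]
  refine mul_le_mul' le_rfl (pow_le_pow_of_le_one bot_le (by simp [h0]) ?_)
  exact (Finset.card_le_univ _).trans (by simp)

lemma cE_mass {n : ℕ} (s : ℝ) (h0 : 0 ≤ s) (h1 : s ≤ 1) (e : Sym2 (Fin n)) :
    ENNReal.ofReal (s * (1 - s) ^ (n ^ 2)) ≤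
      (Measure.pi fun _ : Sym2 (Fin n) => bernoulliB s) {cE e} := by
  have := bern_prob s h0 h1
  rw [Measure.pi_singleton]
  have : ∀ v, bernoulliB s {cE e v} = if v = e then ENNReal.ofReal s else ENNReal.ofReal (1 - s) := by
    intro v
    by_cases hv : v = e
    · simp [cE, hv, bern_true]
    · simp [cE, hv, bern_false]
  simp only [this]
  rw [Finset.prod_ite, Finset.prod_const, Finset.prod_const,
    ENNReal.ofReal_mul (by positivity), ENNReal.ofReal_pow (by linarith)]
  have h2 : (Finset.univ.filter (fun v : Sym2 (Fin n) => v = e)).card = 1 := by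
    simp [Finset.filter_eq']
  rw [h2, pow_one]
  refine mul_le_mul' le_rfl (pow_le_pow_of_le_one bot_le (by simp [h0]) ?_)
  exact (Finset.card_le_univ _).trans (card_sym2_le n)

lemma two_le_of_nondiag {n : ℕ} (e : Sym2 (Fin n)) (he : ¬ e.IsDiag) : 2 ≤ n := by
  have h := card_mem e he
  have := Finset.card_le_univ (Finset.univ.filter (fun v => v ∈ e))
  rw [h] at this
  simpa using this

lemma single (n : ℕ) (p : ℝ) (h0 : 0 ≤ p) (h1 : p ≤ 1) (ht : n * p ≤ 1 / 10) :
    ∃ κ : Measure ((Fin n → Bool) × (Sym2 (Fin n) → Bool)),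
      κ.map Prod.fst = (Measure.pi fun _ : Fin n => bernoulliB p) ∧
      κ.map Prod.snd = (Measure.pi fun _ : Sym2 (Fin n) => bernoulliB (sOf n p)) ∧
      ∀ e : Sym2 (Fin n), ¬ e.IsDiag →
        ENNReal.ofReal (p ^ 2 * (1 - 3 * (n * p))) ≤ κ {(xE e, cE e)} := by
  have hs0 := sOf_nonneg n p h0 h1
  have hs1 := sOf_le n p h0 h1
  have hs2 : sOf n p ≤ 1 := by nlinarith
  have := bern_prob p h0 h1
  have := bern_prob _ hs0 hs2
  have hnp : 0 ≤ n * p := by positivity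
  obtain ⟨κ, k1, k2, k3⟩ := coupling_exists (ι := {e : Sym2 (Fin n) // ¬ e.IsDiag})
    (Measure.pi fun _ : Fin n => bernoulliB p)
    (Measure.pi fun _ : Sym2 (Fin n) => bernoulliB (sOf n p))
    (fun e => xE e.1) (fun e f h => Subtype.ext (xE_inj h))
    (fun e => cE e.1) (fun e f h => Subtype.ext (cE_inj h))
    (ENNReal.ofReal (p ^ 2 * (1 - 3 * (n * p)))) ENNReal.ofReal_ne_top
    (by
      intro e
      refine le_trans (ENNReal.ofReal_le_ofReal ?_) (xE_mass p h0 h1 e.1 e.2)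
      have := one_sub_pow_ge p h0 h1 n
      gcongr
      linarith)
    (by
      intro e
      refine le_trans (ENNReal.ofReal_le_ofReal ?_) (cE_mass _ hs0 hs2 e.1)
      have h5 := one_sub_pow_ge (sOf n p) hs0 hs2 (n ^ 2)
      have h6 := sOf_ge n (two_le_of_nondiag e.1 e.2) p h0 h1 (by linarith)
      push_cast at h5
      have h7 : (n : ℝ) ^ 2 * sOf n p ≤ n * p := by
        calc (n : ℝ) ^ 2 * sOf n p ≤ (n : ℝ) ^ 2 * p ^ 2 := by gcongr
          _ = (n * p) * (n * p) := by ring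
          _ ≤ n * p := by nlinarith
      calc p ^ 2 * (1 - 3 * (n * p)) ≤ p ^ 2 * ((1 - 2 * (n * p)) * (1 - n * p)) := by
            gcongr; nlinarith
        _ = (p ^ 2 * (1 - 2 * (n * p))) * (1 - n * p) := by ring
        _ ≤ sOf n p * (1 - sOf n p) ^ n ^ 2 := by
            apply mul_le_mul h6 (by linarith) (by linarith) hs0)
  exact ⟨κ, k1, k2, fun e he => k3 ⟨e, he⟩⟩

lemma mset {X : Type*} [Finite X] [MeasurableSpace X] [MeasurableSingletonClass X] (s : Set X) :
    MeasurableSet s := (Set.toFinite s).measurableSet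

lemma pi_both {n : ℕ} (p : ℝ) (h0 : 0 ≤ p) (h1 : p ≤ 1) (e : Sym2 (Fin n)) (he : ¬ e.IsDiag) :
    (Measure.pi fun _ : Fin n => bernoulliB p) {x | ∀ v ∈ e, x v = true} =
      ENNReal.ofReal (p ^ 2) := by
  have := bern_prob p h0 h1
  have h2 : {x : Fin n → Bool | ∀ v ∈ e, x v = true} =
      Set.univ.pi (fun v => if v ∈ e then {true} else Set.univ) := by
    ext x
    simp only [Set.mem_ofPred_eq, Set.mem_pi, Set.mem_univ, forall_true_left]
    refine forall_congr' fun v => ?_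
    by_cases hv : v ∈ e <;> simp [hv]
  rw [h2, Measure.pi_pi]
  have : ∀ v, bernoulliB p (if v ∈ e then {true} else Set.univ) =
      if v ∈ e then ENNReal.ofReal p else 1 := by
    intro v
    by_cases hv : v ∈ e
    · simp [hv, bern_true]
    · rw [if_neg hv, if_neg hv, measure_univ]
  simp only [this]
  rw [Finset.prod_ite, Finset.prod_const, Finset.prod_const, card_mem e he,
    ENNReal.ofReal_pow h0]
  simp

lemma pi_coord {ι : Type*} [Fintype ι] (p : ℝ) (h0 : 0 ≤ p) (h1 : p ≤ 1) (e : ι) (b : Bool) :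
    (Measure.pi fun _ : ι => bernoulliB p) {x | x e = b} = bernoulliB p {b} := by
  have := bern_prob p h0 h1
  have h := (measurePreserving_eval (fun _ : ι => bernoulliB p) e).measure_preimage
    (s := {b}) (mset _).nullMeasurableSet
  exact h

lemma single_bounds (n : ℕ) (p : ℝ) (h0 : 0 ≤ p) (h1 : p ≤ 1) (ht : n * p ≤ 1 / 10)
    (κ : Measure ((Fin n → Bool) × (Sym2 (Fin n) → Bool)))
    (k1 : κ.map Prod.fst = (Measure.pi fun _ : Fin n => bernoulliB p))
    (k2 : κ.map Prod.snd = (Measure.pi fun _ : Sym2 (Fin n) => bernoulliB (sOf n p)))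
    (e : Sym2 (Fin n)) (he : ¬ e.IsDiag) 
    (k3 : ENNReal.ofReal (p ^ 2 * (1 - 3 * (n * p))) ≤ κ {(xE e, cE e)}) :
    κ {z | (∀ v ∈ e, z.1 v = true) ∧ z.2 e = false} ≤ ENNReal.ofReal (6 * (n * p) * sOf n p) ∧
    κ {z | z.2 e = true ∧ ¬ ∀ v ∈ e, z.1 v = true} ≤ ENNReal.ofReal (6 * (n * p) * sOf n p) ∧
    κ {z | z.2 e = false} ≤ ENNReal.ofReal (1 - sOf n p) ∧
    κ {z | ¬ ∀ v ∈ e, z.1 v = true} ≤ ENNReal.ofReal (1 - sOf n p) := by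
  have hs0 := sOf_nonneg n p h0 h1
  have hs1 := sOf_le n p h0 h1
  have hs2 : sOf n p ≤ 1 := by nlinarith
  have hge := sOf_ge n (two_le_of_nondiag e he) p h0 h1 (by linarith)
  have b1 := bern_prob p h0 h1
  have b2 := bern_prob _ hs0 hs2
  have hnp : 0 ≤ n * p := by positivity
  have hγ : 0 ≤ p ^ 2 * (1 - 3 * (n * p)) := mul_nonneg (sq_nonneg p) (by linarith)
  have hp2s : p ^ 2 ≤ 2 * sOf n p := by nlinarith [sq_nonneg p]
  have pA : κ {z | ∀ v ∈ e, z.1 v = true} = ENNReal.ofReal (p ^ 2) := by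
    rw [← pi_both p h0 h1 e he, ← k1, Measure.map_apply measurable_fst (mset _)]
    rfl
  have pB : ∀ b, κ {z | z.2 e = b} = bernoulliB (sOf n p) {b} := by
    intro b
    rw [← pi_coord (sOf n p) hs0 hs2 e b, ← k2, Measure.map_apply measurable_snd (mset _)]
    rfl
  have hmass : κ Set.univ = 1 := by
    have : (κ.map Prod.fst) Set.univ = 1 := by rw [k1]; simp
    rwa [Measure.map_apply measurable_fst MeasurableSet.univ, Set.preimage_univ] at this
  have hx : ∀ v ∈ e, xE e v = true := by intro v hv; simp [xE, hv]
  have hc : cE e e = true := by simp [cE]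
  have gen : ∀ (S T : Set ((Fin n → Bool) × (Sym2 (Fin n) → Bool))) (q : ℝ), S ⊆ T →
      (xE e, cE e) ∈ T → (xE e, cE e) ∉ S → κ T = ENNReal.ofReal q → q ≤ p ^ 2 →
      κ S ≤ ENNReal.ofReal (6 * (n * p) * sOf n p) := by
    intro S T q hST hT hS hκ hq
    have hd : Disjoint S {(xE e, cE e)} := by simpa using hS
    have h3 : κ S + κ {(xE e, cE e)} ≤ ENNReal.ofReal q := by
      rw [← measure_union hd (mset _), ← hκ]
      apply measure_mono
      intro z hz
      rcases hz with hz | hz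
      · exact hST hz
      · rw [Set.mem_singleton_iff] at hz
        rw [hz]; exact hT
    have h4 : κ S + ENNReal.ofReal (p ^ 2 * (1 - 3 * (n * p))) ≤ ENNReal.ofReal q :=
      le_trans (by gcongr) h3
    have h5 := ENNReal.le_sub_of_add_le_right ENNReal.ofReal_ne_top h4
    rw [← ENNReal.ofReal_sub _ hγ] at h5
    refine h5.trans (ENNReal.ofReal_le_ofReal ?_)
    nlinarith
  refine ⟨?_, ?_, ?_, ?_⟩
  · refine gen _ {z | ∀ v ∈ e, z.1 v = true} (p ^ 2) (fun z hz => hz.1) hx ?_ pA le_rfl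
    simp [hc]
  · refine gen _ {z | z.2 e = true} (sOf n p) (fun z hz => hz.1) hc ?_ ?_ hs1
    · rintro ⟨_, h⟩
      exact h hx
    · rw [pB, bern_true]
  · rw [pB, bern_false]
  · have : {z : (Fin n → Bool) × (Sym2 (Fin n) → Bool) | ¬ ∀ v ∈ e, z.1 v = true} =
      {z | ∀ v ∈ e, z.1 v = true}ᶜ := rfl
    rw [this, measure_compl (mset _) (by rw [pA]; exact ENNReal.ofReal_ne_top), pA, hmass,
      ← ENNReal.ofReal_one, ← ENNReal.ofReal_sub _ (sq_nonneg p)]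
    apply ENNReal.ofReal_le_ofReal
    linarith

end Single

section Joint

/-- combination map -/
noncomputable def comb {n m : ℕ} (f : Fin m → (Fin n → Bool) × (Sym2 (Fin n) → Bool)) :
    (Fin n → Fin m → Bool) × (Sym2 (Fin n) → Bool) :=
  (fun v w => (f w).1 v, fun e => decide (∃ w, (f w).2 e = true))

lemma or_map (m : ℕ) (s : ℝ) (h0 : 0 ≤ s) (h1 : s ≤ 1) :
    (Measure.pi fun _ : Fin m => bernoulliB s).map (fun x => decide (∃ w, x w = true)) =
      bernoulliB (1 - (1 - s) ^ m) := by
  have := bern_prob s h0 h1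
  have hp1 : (1 - s) ^ m ≤ 1 := pow_le_one₀ (by linarith) (by linarith)
  have hp0 : 0 ≤ (1 - s) ^ m := pow_nonneg (by linarith) _
  have := bern_prob (1 - (1 - s) ^ m) (by linarith) (by linarith)
  have hmeas : Measurable (fun x : Fin m → Bool => decide (∃ w, x w = true)) := measurable_of_finite _
  have := Measure.isProbabilityMeasure_map (μ := Measure.pi fun _ : Fin m => bernoulliB s)
    hmeas.aemeasurable
  have hf : (Measure.pi fun _ : Fin m => bernoulliB s).map (fun x => decide (∃ w, x w = true))
      {false} = bernoulliB (1 - (1 - s) ^ m) {false} := by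
    rw [Measure.map_apply hmeas (mset _), bern_false]
    have : (fun x : Fin m → Bool => decide (∃ w, x w = true)) ⁻¹' {false} = {fun _ => false} := by
      ext x
      simp [funext_iff]
    rw [this, Measure.pi_singleton]
    simp only [bern_false, Finset.prod_const]
    rw [sub_sub_cancel, ENNReal.ofReal_pow (by linarith)]
    simp
  apply Measure.ext_of_singleton
  intro b
  cases b with
  | false => exact hf
  | true =>
    have hc : ({true} : Set Bool) = {false}ᶜ := by ext b; simp
    rw [hc, prob_compl_eq_one_sub (mset _), prob_compl_eq_one_sub (mset _), hf]

lemma swap_map {α β : Type} [Fintype α] [Fintype β] (b : Measure Bool) [IsProbabilityMeasure b] :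
    (Measure.pi fun _ : α => Measure.pi fun _ : β => b).map (fun f v w => f w v) =
      Measure.pi fun _ : β => Measure.pi fun _ : α => b := by
  apply Measure.ext_of_singleton
  intro g
  rw [Measure.map_apply (measurable_of_finite _) (mset _)]
  have : (fun (f : α → β → Bool) v w => f w v) ⁻¹' {g} = {fun w v => g v w} := by
    ext f
    simp only [Set.mem_preimage, Set.mem_singleton_iff, funext_iff]
    exact forall_comm
  rw [this, Measure.pi_singleton, Measure.pi_singleton]
  simp only [Measure.pi_singleton]
  exact Finset.prod_comm

lemma joint (n m : ℕ) (p : ℝ) (h0 : 0 ≤ p) (h1 : p ≤ 1) (ht : n * p ≤ 1 / 10) :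
    ∃ ν : Measure ((Fin n → Fin m → Bool) × (Sym2 (Fin n) → Bool)),
      ν.map Prod.fst = rigMeasure n m p ∧
      ν.map Prod.snd = erMeasure n (pbar n m p) ∧
      ∀ e : Sym2 (Fin n), ¬ e.IsDiag →
        ν {x | ¬ (e ∈ (rigGraph x.1).edgeSet ↔ e ∈ (erGraph x.2).edgeSet)} ≤
          ENNReal.ofReal (12 * (n * p) * pbar n m p) := by
  obtain ⟨κ, k1, k2, k3⟩ := single n p h0 h1 ht
  have hs0 := sOf_nonneg n p h0 h1
  have hs1 := sOf_le n p h0 h1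
  have hs2 : sOf n p ≤ 1 := by nlinarith
  have b1 := bern_prob p h0 h1
  have b2 := bern_prob _ hs0 hs2
  have hnp : 0 ≤ n * p := by positivity
  have hκ : IsProbabilityMeasure κ := by
    constructor
    have : (κ.map Prod.fst) Set.univ = 1 := by rw [k1]; simp
    rwa [Measure.map_apply measurable_fst MeasurableSet.univ, Set.preimage_univ] at this
  have hcomb : Measurable (comb (n := n) (m := m)) := measurable_of_finite _
  have m1 : (Measure.pi fun _ : Fin m => κ).map (fun f w => (f w).1) =
      Measure.pi fun _ : Fin m => Measure.pi fun _ : Fin n => bernoulliB p := by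
    have : ∀ _ : Fin m, SigmaFinite (κ.map Prod.fst) := by rw [k1]; infer_instance
    rw [Measure.pi_map_pi (f := fun (_ : Fin m) z => Prod.fst z) 
      (fun _ => measurable_fst.aemeasurable), k1]
  have m2 : (Measure.pi fun _ : Fin m => κ).map (fun f w => (f w).2) =
      Measure.pi fun _ : Fin m => Measure.pi fun _ : Sym2 (Fin n) => bernoulliB (sOf n p) := by
    have : ∀ _ : Fin m, SigmaFinite (κ.map Prod.snd) := by rw [k2]; infer_instance
    rw [Measure.pi_map_pi (f := fun (_ : Fin m) z => Prod.snd z) 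
      (fun _ => measurable_snd.aemeasurable), k2]
  refine ⟨(Measure.pi fun _ : Fin m => κ).map comb, ?_, ?_, ?_⟩
  · rw [Measure.map_map measurable_fst hcomb]
    unfold rigMeasure
    rw [← swap_map, ← m1, Measure.map_map (measurable_of_finite _) (measurable_of_finite _)]
    rfl
  · rw [Measure.map_map measurable_snd hcomb]
    unfold erMeasure
    have : ∀ _ : Sym2 (Fin n), SigmaFinite ((Measure.pi fun _ : Fin m => bernoulliB (sOf n p)).map
        (fun x => decide (∃ w, x w = true))) := by
      intro _
      have := Measure.isProbabilityMeasure_map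
        (μ := Measure.pi fun _ : Fin m => bernoulliB (sOf n p))
        (f := (fun x => decide (∃ w, x w = true))) (measurable_of_finite _).aemeasurable
      infer_instance
    rw [pbar_eq, ← or_map m _ hs0 hs2]
    rw [← Measure.pi_map_pi (f := fun (_ : Sym2 (Fin n)) (x : Fin m → Bool) =>
        decide (∃ w, x w = true)) (fun _ => (measurable_of_finite _).aemeasurable)]
    rw [← swap_map, ← m2, Measure.map_map (measurable_of_finite _) (measurable_of_finite _),
      Measure.map_map (measurable_of_finite _) (measurable_of_finite _)]
    rfl
  · intro e he
    obtain ⟨c1, c2, c3, c4⟩ := single_bounds n p h0 h1 ht κ k1 k2 e he (k3 e he)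
    rw [Measure.map_apply hcomb (mset _)]
    -- rectangles
    let R₁ : Fin m → Set (Fin m → (Fin n → Bool) × (Sym2 (Fin n) → Bool)) := fun w =>
      Set.univ.pi fun w' => if w' = w then {z | (∀ v ∈ e, z.1 v = true) ∧ z.2 e = false}
        else {z | z.2 e = false}
    let R₂ : Fin m → Set (Fin m → (Fin n → Bool) × (Sym2 (Fin n) → Bool)) := fun w =>
      Set.univ.pi fun w' => if w' = w then {z | z.2 e = true ∧ ¬ ∀ v ∈ e, z.1 v = true}
        else {z | ¬ ∀ v ∈ e, z.1 v = true}
    have hrig : ∀ ω : Fin n → Fin m → Bool, e ∈ (rigGraph ω).edgeSet ↔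
        ∃ w, ∀ v ∈ e, ω v w = true := by
      intro ω
      induction e using Sym2.ind with
      | _ a b =>
        have hab : a ≠ b := by simpa using he
        simp only [rigGraph, SimpleGraph.mem_edgeSet, SimpleGraph.fromRel_adj, Sym2.mem_iff]
        constructor
        · rintro ⟨_, ⟨i, hi⟩ | ⟨i, hi⟩⟩
          · exact ⟨i, by rintro v (rfl | rfl); exacts [hi.1, hi.2]⟩
          · exact ⟨i, by rintro v (rfl | rfl); exacts [hi.2, hi.1]⟩
        · rintro ⟨i, hi⟩
          exact ⟨hab, Or.inl ⟨i, hi a (Or.inl rfl), hi b (Or.inr rfl)⟩⟩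
    have her : ∀ χ : Sym2 (Fin n) → Bool, e ∈ (erGraph χ).edgeSet ↔ χ e = true := by
      intro χ
      induction e using Sym2.ind with
      | _ a b =>
        have hab : a ≠ b := by simpa using he
        simp [erGraph, SimpleGraph.fromRel_adj, hab, Sym2.eq_swap (a := b) (b := a)]
    have hsub : comb ⁻¹' {x | ¬ (e ∈ (rigGraph x.1).edgeSet ↔ e ∈ (erGraph x.2).edgeSet)} ⊆
        (⋃ w, R₁ w) ∪ (⋃ w, R₂ w) := by
      intro f hf
      simp only [Set.mem_preimage, Set.mem_ofPred_eq, hrig, her, comb, decide_eq_true_eq] at hf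
      by_cases hA : ∃ w, ∀ v ∈ e, (f w).1 v = true
      · left
        have hB : ¬ ∃ w, (f w).2 e = true := by tauto
        push Not at hB
        obtain ⟨w, hw⟩ := hA
        refine Set.mem_iUnion.mpr ⟨w, ?_⟩
        intro w' _
        have hBf : (f w').2 e = false := by simpa using hB w'
        by_cases h : w' = w
        · subst h
          simp only [if_true]
          exact ⟨hw, hBf⟩
        · simp only [h, if_false]
          exact hBf
      · right
        have hB : ∃ w, (f w).2 e = true := by tauto
        obtain ⟨w, hw⟩ := hB
        refine Set.mem_iUnion.mpr ⟨w, ?_⟩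
        intro w' _
        have hAf : ¬ ∀ v ∈ e, (f w').1 v = true := fun h => hA ⟨w', h⟩
        by_cases h : w' = w
        · subst h
          simp only [if_true]
          exact ⟨hw, hAf⟩
        · simp only [h, if_false]
          exact hAf
    have rect : ∀ (S T : Set ((Fin n → Bool) × (Sym2 (Fin n) → Bool))) (w : Fin m),
        κ S ≤ ENNReal.ofReal (6 * (n * p) * sOf n p) → κ T ≤ ENNReal.ofReal (1 - sOf n p) →
        (Measure.pi fun _ : Fin m => κ) (Set.univ.pi fun w' => if w' = w then S else T) ≤
          ENNReal.ofReal (6 * (n * p) * sOf n p * (1 - sOf n p) ^ (m - 1)) := by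
      intro S T w hS hT
      rw [Measure.pi_pi, ← Finset.mul_prod_erase _ _ (Finset.mem_univ w)]
      rw [ENNReal.ofReal_mul (by positivity), ENNReal.ofReal_pow (by linarith)]
      simp only [if_true]
      refine mul_le_mul' hS ?_
      have : ∏ x ∈ Finset.univ.erase w, κ (if x = w then S else T) =
          ∏ x ∈ Finset.univ.erase w, κ T := by
        refine Finset.prod_congr rfl fun x hx => ?_
        rw [if_neg (Finset.ne_of_mem_erase hx)]
      rw [this, Finset.prod_const, Finset.card_erase_of_mem (Finset.mem_univ w)]
      simp only [Finset.card_univ, Fintype.card_fin]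
      gcongr
    have s1 : (Measure.pi fun _ : Fin m => κ) (⋃ w, R₁ w) ≤
        ENNReal.ofReal (6 * (n * p) * pbar n m p) := by
      refine (measure_iUnion_fintype_le _ _).trans ?_
      refine (Finset.sum_le_sum fun w _ => rect _ _ w c1 c3).trans ?_
      rw [Finset.sum_const, nsmul_eq_mul, Finset.card_univ, Fintype.card_fin,
        ← ENNReal.ofReal_natCast, ← ENNReal.ofReal_mul (by positivity)]
      apply ENNReal.ofReal_le_ofReal
      calc _ = 6 * (n * p) * (m * sOf n p * (1 - sOf n p) ^ (m - 1)) := by ring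
        _ ≤ _ := by
          have := pbar_ge n m p h0 h1
          gcongr
    have s2 : (Measure.pi fun _ : Fin m => κ) (⋃ w, R₂ w) ≤
        ENNReal.ofReal (6 * (n * p) * pbar n m p) := by
      refine (measure_iUnion_fintype_le _ _).trans ?_
      refine (Finset.sum_le_sum fun w _ => rect _ _ w c2 c4).trans ?_
      rw [Finset.sum_const, nsmul_eq_mul, Finset.card_univ, Fintype.card_fin,
        ← ENNReal.ofReal_natCast, ← ENNReal.ofReal_mul (by positivity)]
      apply ENNReal.ofReal_le_ofReal
      calc _ = 6 * (n * p) * (m * sOf n p * (1 - sOf n p) ^ (m - 1)) := by ring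
        _ ≤ _ := by
          have := pbar_ge n m p h0 h1
          gcongr
    have hpb := pbar_nonneg n m p h0 h1
    calc _ ≤ _ := measure_mono hsub
      _ ≤ _ := measure_union_le _ _
      _ ≤ _ := add_le_add s1 s2
      _ = _ := by
        rw [← ENNReal.ofReal_add (by positivity) (by positivity)]
        congr 1
        ring

end Joint

section Final

/-- non-loop pairs -/
noncomputable def nd (n : ℕ) : Finset (Sym2 (Fin n)) := Finset.univ.filter (fun e => ¬ e.IsDiag)

lemma EF_er {n : ℕ} (χ : Sym2 (Fin n) → Bool) :
    EF (erGraph χ) = (nd n).filter (fun e => χ e = true) := by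
  ext e
  induction e using Sym2.ind with
  | _ a b =>
    simp only [EF, nd, Finset.mem_filter, Finset.mem_univ, true_and, SimpleGraph.mem_edgeSet]
    simp [erGraph, SimpleGraph.fromRel_adj, Sym2.eq_swap (a := b) (b := a)]

lemma EF_card {n : ℕ} (χ : Sym2 (Fin n) → Bool) :
    ((EF (erGraph χ)).card : ℝ) =
      (∑ e ∈ nd n, fun χ : Sym2 (Fin n) → Bool => if χ e = true then (1 : ℝ) else 0) χ := by
  rw [EF_er, Finset.card_filter, Finset.sum_apply]
  push_cast
  rfl

lemma conc (n : ℕ) (q : ℝ) (h0 : 0 ≤ q) (h1 : q ≤ 1) (hμ : 0 < (nd n).card * q) :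
    erMeasure n q {χ | ((EF (erGraph χ)).card : ℝ) < (nd n).card * q / 2} ≤
      ENNReal.ofReal (4 / ((nd n).card * q)) := by
  have := bern_prob q h0 h1
  unfold erMeasure
  set P : Measure (Sym2 (Fin n) → Bool) := Measure.pi fun _ => bernoulliB q with hP
  let Y : Sym2 (Fin n) → (Sym2 (Fin n) → Bool) → ℝ := fun e χ => if χ e = true then (1 : ℝ) else 0
  set μ : ℝ := (nd n).card * q with hμdef
  have hL : ∀ f : (Sym2 (Fin n) → Bool) → ℝ, MemLp f 2 P := by
    intro f
    obtain ⟨C, hC⟩ := (Set.finite_range (fun x => ‖f x‖)).bddAbove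
    exact MemLp.of_bound (measurable_of_finite f).aestronglyMeasurable C
      (Filter.Eventually.of_forall fun x => hC ⟨x, rfl⟩)
  have hIntg : ∀ f : (Sym2 (Fin n) → Bool) → ℝ, Integrable f P := fun f => (hL f).integrable (by norm_num)
  have hEY : ∀ e, ∫ χ, Y e χ ∂P = q := by
    intro e
    have : Y e = Set.indicator {χ | χ e = true} 1 := by
      ext χ
      simp [Y, Set.indicator]
    rw [this, integral_indicator_one (mset _), Measure.real, hP, pi_coord q h0 h1, bern_true,
      ENNReal.toReal_ofReal h0]
  have hE : ∫ χ, (∑ e ∈ nd n, Y e) χ ∂P = μ := by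
    simp only [Finset.sum_apply]
    rw [integral_finsetSum _ (fun e _ => hIntg _)]
    simp [hEY, hμdef]
  have hvar : ProbabilityTheory.variance (∑ e ∈ nd n, Y e) P ≤ μ := by
    rw [ProbabilityTheory.IndepFun.variance_sum (fun e _ => hL _)]
    · have : ∀ e ∈ nd n, ProbabilityTheory.variance (Y e) P ≤ q := by
        intro e _
        refine (ProbabilityTheory.variance_le_expectation_sq
          (measurable_of_finite _).aestronglyMeasurable).trans ?_
        have : Y e ^ 2 = Y e := by
          ext χ
          simp [Y]
        rw [this, hEY]
      refine (Finset.sum_le_sum this).trans ?_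
      simp [hμdef]
    · intro e _ f _ hef
      have hi := ProbabilityTheory.iIndepFun_pi (μ := fun _ : Sym2 (Fin n) => bernoulliB q)
        (X := fun _ (b : Bool) => if b = true then (1 : ℝ) else 0)
        (fun _ => (measurable_of_finite _).aemeasurable)
      exact hi.indepFun hef
  have hch := ProbabilityTheory.meas_ge_le_variance_div_sq (hL (∑ e ∈ nd n, Y e)) (c := μ / 2)
    (by positivity)
  rw [hE] at hch
  refine le_trans (measure_mono ?_) (hch.trans (ENNReal.ofReal_le_ofReal ?_))
  · intro χ hχ
    simp only [Set.mem_ofPred_eq] at hχ ⊢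
    rw [EF_card] at hχ
    change (∑ e ∈ nd n, Y e) χ < μ / 2 at hχ
    rw [abs_of_neg (by linarith)]
    linarith
  · calc _ ≤ μ / (μ / 2) ^ 2 := by gcongr
      _ = 4 / μ := by field_simp; norm_num

lemma DF_sub {n m : ℕ} (ω : Fin n → Fin m → Bool) (χ : Sym2 (Fin n) → Bool) :
    DF (rigGraph ω) (erGraph χ) = (nd n).filter
      (fun e => ¬ (e ∈ (rigGraph ω).edgeSet ↔ e ∈ (erGraph χ).edgeSet)) := by
  ext e
  simp only [DF, nd, Finset.mem_filter, Finset.mem_univ, true_and]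
  constructor
  · intro h
    refine ⟨fun hd => h ?_, h⟩
    constructor
    · intro h; exact absurd hd (SimpleGraph.not_isDiag_of_mem_edgeSet _ h)
    · intro h; exact absurd hd (SimpleGraph.not_isDiag_of_mem_edgeSet _ h)
  · exact fun h => h.2

lemma expD {n m : ℕ} (ν : Measure ((Fin n → Fin m → Bool) × (Sym2 (Fin n) → Bool))) (r : ℝ)
    (h : ∀ e : Sym2 (Fin n), ¬ e.IsDiag →
        ν {x | ¬ (e ∈ (rigGraph x.1).edgeSet ↔ e ∈ (erGraph x.2).edgeSet)} ≤ ENNReal.ofReal r) :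
    ∫⁻ x, ((DF (rigGraph x.1) (erGraph x.2)).card : ENNReal) ∂ν ≤
      ENNReal.ofReal ((nd n).card * r) := by
  have : ∀ x : (Fin n → Fin m → Bool) × (Sym2 (Fin n) → Bool),
      ((DF (rigGraph x.1) (erGraph x.2)).card : ENNReal) =
      ∑ e ∈ nd n, Set.indicator {x : (Fin n → Fin m → Bool) × (Sym2 (Fin n) → Bool) |
        ¬ (e ∈ (rigGraph x.1).edgeSet ↔ e ∈ (erGraph x.2).edgeSet)} 1 x := by
    intro x
    rw [DF_sub, Finset.card_filter]
    push_cast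
    refine Finset.sum_congr rfl fun e _ => ?_
    simp only [Set.indicator, Set.mem_ofPred_eq, Pi.one_apply]
  simp only [this]
  rw [lintegral_finsetSum _ (fun e _ => measurable_of_finite _)]
  rw [ENNReal.ofReal_mul (by positivity), ENNReal.ofReal_natCast, ← nsmul_eq_mul]
  apply Finset.sum_le_card_nsmul
  intro e he
  rw [lintegral_indicator_one (mset _)]
  exact h e (by simpa [nd] using he)

lemma markovD {n m : ℕ} (ν : Measure ((Fin n → Fin m → Bool) × (Sym2 (Fin n) → Bool))) (r c : ℝ)
    (hc : 0 < c) 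
    (h : ∫⁻ x, ((DF (rigGraph x.1) (erGraph x.2)).card : ENNReal) ∂ν ≤ ENNReal.ofReal r) :
    ν {x | c ≤ ((DF (rigGraph x.1) (erGraph x.2)).card : ℝ)} ≤ ENNReal.ofReal (r / c) := by
  have h2 := meas_ge_le_lintegral_div (μ := ν)
    (f := fun x => ((DF (rigGraph x.1) (erGraph x.2)).card : ENNReal))
    (measurable_of_finite _).aemeasurable (ε := ENNReal.ofReal c) (by simpa using hc)
    ENNReal.ofReal_ne_top
  rw [ENNReal.ofReal_div_of_pos hc]
  refine le_trans (measure_mono ?_) (h2.trans (by gcongr))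
  intro x hx
  simp only [Set.mem_ofPred_eq] at hx ⊢
  rw [← ENNReal.ofReal_natCast]
  exact ENNReal.ofReal_le_ofReal hx

lemma final_bound (n m : ℕ) (p δ : ℝ) (h0 : 0 ≤ p) (h1 : p ≤ 1) (ht : n * p ≤ 1 / 10) :
    ∃ ν : Measure ((Fin n → Fin m → Bool) × (Sym2 (Fin n) → Bool)),
      ν.map Prod.fst = rigMeasure n m p ∧
      ν.map Prod.snd = erMeasure n (pbar n m p) ∧
      ν {x | |modularity (rigGraph x.1) - modularity (erGraph x.2)| ≤
              12 * ((n : ℝ) * p) ^ ((1 : ℝ) - δ)}ᶜ ≤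
        ENNReal.ofReal (16 * √(n * p) + 12 * (n * p) ^ δ) := by
  obtain ⟨ν, v1, v2, v3⟩ := joint n m p h0 h1 ht
  refine ⟨ν, v1, v2, ?_⟩
  have hD := expD ν _ v3
  have hq0 := pbar_nonneg n m p h0 h1
  have hq1 := pbar_le_one n m p
  have hconc := conc n (pbar n m p) hq0 hq1
  set μ : ℝ := (nd n).card * pbar n m p with hμ
  have hμ0 : 0 ≤ μ := by positivity
  have e1 : ((nd n).card : ℝ) * (12 * (n * p) * pbar n m p) = 12 * (n * p) * μ := by rw [hμ]; ring
  rw [e1] at hD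
  have ht0 : 0 ≤ n * p := by positivity
  set t : ℝ := n * p with htdef
  have hs := Real.sqrt_nonneg t
  have hss := Real.mul_self_sqrt ht0
  have hpow : 0 ≤ t ^ δ := Real.rpow_nonneg ht0 _
  have hpow' : 0 ≤ t ^ (1 - δ) := Real.rpow_nonneg ht0 _
  by_cases hcase : μ * √t ≤ 1
  · have := markovD ν _ 1 one_pos hD
    refine le_trans (measure_mono ?_) (this.trans (ENNReal.ofReal_le_ofReal ?_))
    · intro x hx
      by_contra hcon
      apply hx
      simp only [Set.mem_ofPred_eq, not_le] at hcon ⊢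
      have h3 : (DF (rigGraph x.1) (erGraph x.2)).card = 0 := by
        have : (DF (rigGraph x.1) (erGraph x.2)).card < 1 := by exact_mod_cast hcon
        omega
      rw [eq_of_DF _ _ (Finset.card_eq_zero.mp h3)]
      simp only [sub_self, abs_zero]
      positivity
    · rw [div_one]
      have : t * μ ≤ √t := by
        calc t * μ = √t * (μ * √t) := by rw [← hss]; simp [hss]; linear_combination (-μ) * hss
          _ ≤ √t * 1 := by gcongr
          _ = √t := mul_one _
      nlinarith
  · push Not at hcase
    have htpos : 0 < t := by
      rcases ht0.eq_or_lt with h | h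
      · rw [← h] at hcase; simp at hcase; linarith
      · exact h
    have hspos : 0 < √t := Real.sqrt_pos.mpr htpos
    have hμpos : 0 < μ := by
      by_contra h
      have : μ = 0 := by linarith
      rw [this] at hcase
      simp at hcase
      linarith
    have hpp : 0 < t ^ (1 - δ) := Real.rpow_pos_of_pos htpos _
    have b1 := hconc hμpos
    rw [← v2, Measure.map_apply measurable_snd (mset _)] at b1
    have b2 := markovD ν _ (t ^ (1 - δ) * μ) (by positivity) hD
    have hsub : {x : (Fin n → Fin m → Bool) × (Sym2 (Fin n) → Bool) |
        |modularity (rigGraph x.1) - modularity (erGraph x.2)| ≤ 12 * t ^ ((1 : ℝ) - δ)}ᶜ ⊆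
        Prod.snd ⁻¹' {χ | ((EF (erGraph χ)).card : ℝ) < μ / 2} ∪
        {x | t ^ (1 - δ) * μ ≤ ((DF (rigGraph x.1) (erGraph x.2)).card : ℝ)} := by
      intro x hx
      by_contra hcon
      apply hx
      simp only [Set.mem_union, Set.mem_preimage, Set.mem_ofPred_eq, not_or, not_lt, not_le]
        at hcon ⊢
      obtain ⟨a1, a2⟩ := hcon
      have a3 : (0 : ℝ) < (EF (erGraph x.2)).card := by linarith
      refine (mod_diff _ _ (by exact_mod_cast a3)).trans ?_
      rw [div_le_iff₀ a3]
      nlinarith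
    refine (measure_mono hsub).trans ((measure_union_le _ _).trans ((add_le_add b1 b2).trans ?_))
    rw [← ENNReal.ofReal_add (by positivity) (by positivity)]
    apply ENNReal.ofReal_le_ofReal
    have c1 : 4 / μ ≤ 4 * √t := by
      rw [div_le_iff₀ hμpos]
      nlinarith
    have c2 : 12 * t * μ / (t ^ (1 - δ) * μ) = 12 * t ^ δ := by
      rw [mul_div_mul_right _ _ hμpos.ne', div_eq_iff hpp.ne', mul_assoc, ← Real.rpow_add htpos]
      simp
    rw [c2]
    linarith

lemma rig_prob (n m : ℕ) (p : ℝ) (h0 : 0 ≤ p) (h1 : p ≤ 1) :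
    IsProbabilityMeasure (rigMeasure n m p) := by
  have := bern_prob p h0 h1
  unfold rigMeasure
  infer_instance

lemma er_prob (n : ℕ) (p : ℝ) (h0 : 0 ≤ p) (h1 : p ≤ 1) :
    IsProbabilityMeasure (erMeasure n p) := by
  have := bern_prob p h0 h1
  unfold erMeasure
  infer_instance

lemma final_all (n m : ℕ) (p δ : ℝ) (h0 : 0 ≤ p) (h1 : p ≤ 1) :
    ∃ ν : Measure ((Fin n → Fin m → Bool) × (Sym2 (Fin n) → Bool)),
      ν.map Prod.fst = rigMeasure n m p ∧
      ν.map Prod.snd = erMeasure n (pbar n m p) ∧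
      (n * p ≤ 1 / 10 → ν {x | |modularity (rigGraph x.1) - modularity (erGraph x.2)| ≤
              12 * ((n : ℝ) * p) ^ ((1 : ℝ) - δ)}ᶜ ≤
        ENNReal.ofReal (16 * √(n * p) + 12 * (n * p) ^ δ)) := by
  by_cases h : n * p ≤ 1 / 10
  · obtain ⟨ν, a, b, c⟩ := final_bound n m p δ h0 h1 h
    exact ⟨ν, a, b, fun _ => c⟩
  · have := rig_prob n m p h0 h1
    have := er_prob n (pbar n m p) (pbar_nonneg n m p h0 h1) (pbar_le_one n m p)
    refine ⟨(rigMeasure n m p).prod (erMeasure n (pbar n m p)), ?_, ?_, fun h' => absurd h' h⟩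
    · rw [Measure.map_fst_prod, measure_univ, one_smul]
    · rw [Measure.map_snd_prod, measure_univ, one_smul]

end Final

/-- Theorem 4 (Thm:LikeGnp): if `n p = o(1)` then, with `p̄` as above, for any
`δ > 0` there are a coupling `ν n` of `G(n,m,p)` and `G(n,p̄)`, a sequence
`ε_n → 0` and a constant `C` such that with high probability
`|mod(G(n,m,p)) - mod(G(n,p̄))| ≤ ε_n mod(G(n,p̄)) + C (np)^{1-δ}`. -/
theorem modularity_like_gnp (m : ℕ → ℕ) (p : ℕ → ℝ)
    (hp : ∀ n, 0 ≤ p n ∧ p n ≤ 1)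
    (h1 : Tendsto (fun n : ℕ => (n : ℝ) * p n) atTop (nhds 0)) :
    ∀ δ : ℝ, 0 < δ →
      ∃ (ν : (n : ℕ) → Measure ((Fin n → Fin (m n) → Bool) × (Sym2 (Fin n) → Bool)))
        (ε : ℕ → ℝ) (C : ℝ),
        (∀ n, (ν n).map Prod.fst = rigMeasure n (m n) (p n)) ∧
        (∀ n, (ν n).map Prod.snd = erMeasure n (pbar n (m n) (p n))) ∧
        Tendsto ε atTop (nhds 0) ∧
        Tendsto (fun n : ℕ => ν n
            {x | |modularity (rigGraph x.1) - modularity (erGraph x.2)| ≤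
              ε n * modularity (erGraph x.2) + C * ((n : ℝ) * p n) ^ ((1 : ℝ) - δ)})
          atTop (nhds 1) := by
  intro δ hδ
  choose ν v1 v2 v3 using fun n => final_all n (m n) (p n) δ (hp n).1 (hp n).2
  refine ⟨ν, fun _ => 0, 12, v1, v2, tendsto_const_nhds, ?_⟩
  have hprob : ∀ n, IsProbabilityMeasure (ν n) := by
    intro n
    have := rig_prob n (m n) (p n) (hp n).1 (hp n).2
    constructor
    have : ((ν n).map Prod.fst) Set.univ = 1 := by rw [v1]; simp
    rwa [Measure.map_apply measurable_fst MeasurableSet.univ, Set.preimage_univ] at this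
  have hlim : Tendsto (fun n : ℕ => ENNReal.ofReal (16 * √(n * p n) + 12 * (n * p n) ^ δ))
      atTop (nhds 0) := by
    have a1 : Tendsto (fun n : ℕ => √((n : ℝ) * p n)) atTop (nhds 0) := by
      have := (Real.continuous_sqrt.tendsto 0).comp h1
      rw [Real.sqrt_zero] at this
      exact this
    have a2 : Tendsto (fun n : ℕ => ((n : ℝ) * p n) ^ δ) atTop (nhds 0) := by
      have := h1.rpow_const (p := δ) (Or.inr hδ.le)
      rwa [Real.zero_rpow hδ.ne'] at this
    have a3 := (a1.const_mul 16).add (a2.const_mul 12)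
    have a4 := ENNReal.tendsto_ofReal a3
    rw [mul_zero, mul_zero, add_zero, ENNReal.ofReal_zero] at a4
    exact a4
  have hlow : Tendsto (fun n : ℕ =>
      1 - ENNReal.ofReal (16 * √(n * p n) + 12 * (n * p n) ^ δ)) atTop (nhds 1) := by
    have := ENNReal.Tendsto.sub (tendsto_const_nhds (x := (1 : ENNReal))) hlim
      (Or.inl ENNReal.one_ne_top)
    rw [tsub_zero] at this
    exact this
  refine tendsto_of_tendsto_of_tendsto_of_le_of_le' hlow tendsto_const_nhds ?_
    (Eventually.of_forall fun n => prob_le_one)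
  have hev : ∀ᶠ n : ℕ in atTop, (n : ℝ) * p n ≤ 1 / 10 :=
    (h1.eventually (gt_mem_nhds (by norm_num : (0 : ℝ) < 1 / 10))).mono fun n h => h.le
  filter_upwards [hev] with n hn
  have hb := v3 n hn
  rw [prob_compl_eq_one_sub (mset _)] at hb
  simp only [zero_mul, zero_add]
  rw [tsub_le_iff_right] at hb ⊢
  rwa [add_comm] at hb


end RIG
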